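/- There is no k[s]-module N such that 𝔅' ⊗_{k[s]} N is isomorphic to k[s] as a k[s]-module. In particular, 𝔅' is not an invertible k[s]-module. -/

import Mathlib

open TensorProduct

/-- The `k[s]`-submodule `𝔅'` of `k(s)` generated by the elements `1/(s+i)` for `i ∈ ℤ`. -/
noncomputable def Bprime (k : Type*) [Field k] : Submodule (Polynomial k) (RatFunc k) :=
  Submodule.span (Polynomial k) {x : RatFunc k | ∃ i : ℤ, x = (RatFunc.X + (i : RatFunc k))⁻¹}

/-- The submodule `𝔅'` is not finitely generated: a common denominator would vanish at every
integer. -/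
theorem not_fg_Bprime (k : Type*) [Field k] [CharZero k] : ¬ (Bprime k).FG := by
  intro hfg
  obtain ⟨d, hd, hden⟩ :=
    FractionalIdeal.isFractional_of_fg (S := nonZeroDivisors (Polynomial k)) hfg
  have hroot (i : ℤ) : d.eval (-(i : k)) = 0 := by
    obtain ⟨p, hp⟩ := hden _ (Submodule.subset_span ⟨i, rfl⟩)
    have hX : algebraMap (Polynomial k) (RatFunc k) (Polynomial.X + Polynomial.C (i : k)) =
        RatFunc.X + (i : RatFunc k) := by
      simp
    have hne : (RatFunc.X + (i : RatFunc k)) ≠ 0 := by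
      rw [← hX]
      exact RatFunc.algebraMap_ne_zero (Polynomial.X_add_C_ne_zero _)
    have hdp : d = p * (Polynomial.X + Polynomial.C (i : k)) := by
      apply RatFunc.algebraMap_injective k
      rw [map_mul, hX, hp, Algebra.smul_def, mul_assoc, inv_mul_cancel₀ hne, mul_one]
    rw [hdp]
    simp
  refine nonZeroDivisors.ne_zero hd (Polynomial.eq_zero_of_infinite_isRoot d ?_)
  refine (Set.infinite_range_of_injective (f := fun i : ℤ => -(i : k)) ?_).mono ?_
  · exact neg_injective.comp Int.cast_injective
  · rintro _ ⟨i, rfl⟩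
    exact hroot i

/-- There is no `k[s]`-module `N` with `𝔅' ⊗_{k[s]} N ≅ k[s]`; in particular `𝔅'` is not an
invertible `k[s]`-module. -/
theorem stmt3 (k : Type*) [Field k] [CharZero k]
    (N : Type*) [AddCommGroup N] [Module (Polynomial k) N] :
    IsEmpty ((↥(Bprime k) ⊗[Polynomial k] N) ≃ₗ[Polynomial k] Polynomial k) := by
  refine ⟨fun e => not_fg_Bprime k ?_⟩
  have : Module.Invertible (Polynomial k) (Bprime k) := .left e
  exact Module.Finite.iff_fg.mp inferInstance
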